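/- arXiv:2512.18008 — 3 statements merged into one kernel-verified Lean document; each statement's English description precedes it below -/
import Mathlib

section
/- The irrotational radial profile g(r) = F(r)/r tends to 0 as r → 0 from the right. -/
noncomputable def Fanti (σ ρ r : ℝ) : ℝ :=
  (2 * r * σ * Real.sinh (σ * ρ) +
    Real.cosh (σ * ρ) *
      (Real.log (Real.cosh (σ * (r - ρ))) - Real.log (Real.cosh (σ * (r + ρ))))) /
  (2 * σ * Real.sinh (σ * ρ))

theorem Fanti_zero (σ ρ : ℝ) : Fanti σ ρ 0 = 0 := by
  simp [Fanti]

theorem hasDerivAt_log_cosh_mul_add (σ c r : ℝ) :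
    HasDerivAt (fun r => Real.log (Real.cosh (σ * (r + c)))) (σ * Real.tanh (σ * (r + c))) r := by
  have h : HasDerivAt (fun r => σ * (r + c)) σ r := by
    simpa using ((hasDerivAt_id r).add_const c).const_mul σ
  convert h.cosh.log (Real.cosh_pos _).ne' using 1
  rw [Real.tanh_eq_sinh_div_cosh]
  ring

theorem hasDerivAt_Fanti (σ ρ r : ℝ) :
    HasDerivAt (Fanti σ ρ)
      ((2 * σ * Real.sinh (σ * ρ) +
        Real.cosh (σ * ρ) * (σ * Real.tanh (σ * (r - ρ)) - σ * Real.tanh (σ * (r + ρ)))) /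
      (2 * σ * Real.sinh (σ * ρ))) r := by
  have hlin : HasDerivAt (fun r : ℝ => 2 * r * σ * Real.sinh (σ * ρ))
      (2 * σ * Real.sinh (σ * ρ)) r := by
    simpa using (((hasDerivAt_id r).const_mul 2).mul_const σ).mul_const (Real.sinh (σ * ρ))
  have hsub := hasDerivAt_log_cosh_mul_add σ (-ρ) r
  simp only [← sub_eq_add_neg] at hsub
  exact (hlin.add ((hsub.sub (hasDerivAt_log_cosh_mul_add σ ρ r)).const_mul _)).div_const _

theorem hasDerivAt_Fanti_zero (σ ρ : ℝ) : HasDerivAt (Fanti σ ρ) 0 0 := by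
  convert hasDerivAt_Fanti σ ρ 0 using 1
  have hc : Real.cosh (σ * ρ) ≠ 0 := (Real.cosh_pos _).ne'
  rw [zero_sub, zero_add, mul_neg, Real.tanh_neg, Real.tanh_eq_sinh_div_cosh]
  field_simp
  ring

theorem g_tendsto_zero_at_origin (σ ρ : ℝ) (hσ : 0 < σ) (hρ : 0 < ρ) :
    Filter.Tendsto (fun r => Fanti σ ρ r / r)
      (nhdsWithin 0 (Set.Ioi 0)) (nhds 0) := by
  simpa [Fanti_zero, div_eq_inv_mul] using
    (hasDerivAt_Fanti_zero σ ρ).tendsto_slope_zero_right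
end

section
/- As r → 0, the irrotational form function has the quadratic expansion 1 − f_Alc(r) = (σ²/cosh(σρ)²)·r² + O(r⁴); precisely, the function r ↦ (1 − f_Alc(r)) − (σ²/cosh(σρ)²)·r² is big-O of r⁴ in a neighborhood of 0. -/
open Asymptotics

noncomputable def fAlc (σ ρ r : ℝ) : ℝ :=
  (Real.tanh (σ * (r + ρ)) - Real.tanh (σ * (r - ρ))) / (2 * Real.tanh (σ * ρ))

theorem sinh_sub_self_isBigO : (fun x : ℝ => Real.sinh x - x) =O[nhds 0] (fun x : ℝ => x ^ 3) := by
  have h := Real.exp_sub_sum_range_isBigO_pow 3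
  have hneg : Filter.Tendsto (fun x : ℝ => -x) (nhds 0) (nhds 0) := by
    simpa using (continuous_neg (G := ℝ)).tendsto 0
  have h' : (fun x : ℝ => Real.exp (-x) - ∑ i ∈ Finset.range 3, (-x) ^ i / (i.factorial : ℝ))
      =O[nhds 0] (fun x : ℝ => x ^ 3) := by
    refine (h.comp_tendsto hneg).trans (IsBigO.of_bound 1 (.of_forall fun x => ?_))
    simp
  refine ((h.sub h').const_mul_left (1 / 2)).congr_left fun x => ?_
  simp only [Finset.sum_range_succ, Finset.sum_range_zero, Nat.factorial, Real.sinh_eq]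
  push_cast
  ring

theorem sinh_isBigO_self : Real.sinh =O[nhds 0] (fun x : ℝ => x) := by
  simpa using (Real.hasDerivAt_sinh 0).isBigO_sub

theorem sinh_sq_sub_sq_isBigO :
    (fun x : ℝ => Real.sinh x ^ 2 - x ^ 2) =O[nhds 0] (fun x : ℝ => x ^ 4) := by
  refine (sinh_sub_self_isBigO.mul (sinh_isBigO_self.add (isBigO_refl _ _))).congr
    (fun x => ?_) (fun x => ?_) <;> ring

theorem one_sub_fAlc {σ ρ : ℝ} (h : σ * ρ ≠ 0) (r : ℝ) :
    1 - fAlc σ ρ r =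
      Real.sinh (σ * r) ^ 2 / (Real.cosh (σ * ρ) ^ 2 + Real.sinh (σ * r) ^ 2) := by
  have hS : Real.sinh (σ * ρ) ≠ 0 := by simpa using h
  have hC := (Real.cosh_pos (σ * ρ)).ne'
  have hp := (Real.cosh_pos (σ * r + σ * ρ)).ne'
  have hm := (Real.cosh_pos (σ * r - σ * ρ)).ne'
  have hD : Real.cosh (σ * ρ) ^ 2 + Real.sinh (σ * r) ^ 2 ≠ 0 := by positivity
  have hprod : Real.cosh (σ * r + σ * ρ) * Real.cosh (σ * r - σ * ρ) =
      Real.cosh (σ * ρ) ^ 2 + Real.sinh (σ * r) ^ 2 := by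
    rw [Real.cosh_add, Real.cosh_sub]
    linear_combination Real.cosh (σ * ρ) ^ 2 * Real.cosh_sq (σ * r) +
      Real.sinh (σ * r) ^ 2 * Real.cosh_sq (σ * ρ)
  have hnum : Real.sinh (σ * r + σ * ρ) * Real.cosh (σ * r - σ * ρ) -
      Real.cosh (σ * r + σ * ρ) * Real.sinh (σ * r - σ * ρ) =
      2 * Real.sinh (σ * ρ) * Real.cosh (σ * ρ) := by
    rw [← Real.sinh_sub, ← Real.sinh_two_mul]
    ring_nf
  rw [fAlc, mul_add, mul_sub, Real.tanh_eq_sinh_div_cosh, Real.tanh_eq_sinh_div_cosh,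
    Real.tanh_eq_sinh_div_cosh, div_sub_div _ _ hp hm, hnum, hprod]
  field_simp
  ring

theorem f_quadratic_expansion (σ ρ : ℝ) (hσ : 0 < σ) (hρ : 0 < ρ) :
    (fun r : ℝ => (1 - fAlc σ ρ r) - (σ ^ 2 / (Real.cosh (σ * ρ)) ^ 2) * r ^ 2)
      =O[nhds 0] (fun r : ℝ => r ^ 4) := by
  set C := Real.cosh (σ * ρ) with hC_def
  have hC : 0 < C := Real.cosh_pos _
  have hnum : (fun x : ℝ => C ^ 2 * (Real.sinh x ^ 2 - x ^ 2) - x ^ 2 * Real.sinh x ^ 2)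
      =O[nhds 0] (fun x : ℝ => x ^ 4) :=
    (sinh_sq_sub_sq_isBigO.const_mul_left _).sub
      (((isBigO_refl (fun x : ℝ => x ^ 2) _).mul (sinh_isBigO_self.pow 2)).congr_right fun x => by ring)
  have hden : (fun x : ℝ => (C ^ 2 * (C ^ 2 + Real.sinh x ^ 2))⁻¹)
      =O[nhds 0] (fun _ : ℝ => (1 : ℝ)) := by
    have hcont : Continuous fun x : ℝ => (C ^ 2 * (C ^ 2 + Real.sinh x ^ 2))⁻¹ :=
      Continuous.inv₀ (by fun_prop) fun x => by positivity
    exact (hcont.tendsto 0).isBigO_one ℝ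
  have hlin : Filter.Tendsto (fun r : ℝ => σ * r) (nhds 0) (nhds 0) := by
    simpa using (continuous_const_mul σ).tendsto 0
  have hscale : (fun r : ℝ => 1 * (σ * r) ^ 4) =O[nhds 0] (fun r : ℝ => r ^ 4) :=
    ((isBigO_refl (fun r : ℝ => r ^ 4) _).const_mul_left (σ ^ 4)).congr_left fun r => by ring
  refine (((hden.mul hnum).comp_tendsto hlin).trans hscale).congr_left fun r => ?_
  rw [one_sub_fAlc (mul_pos hσ hρ).ne', ← hC_def]
  simp only [Function.comp_apply]
  have hD : C ^ 2 + Real.sinh (σ * r) ^ 2 ≠ 0 := by positivity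
  field_simp
  ring
end

section
/- The far-field expansion of the irrotational profile holds: r·(g(r) − 1) → −ρ·cosh(σρ)/sinh(σρ) as r → +∞; in particular g(r) → 1 as r → +∞. -/
open Filter Topology

theorem tendsto_log_cosh_sub_self :
    Tendsto (fun x : ℝ => Real.log (Real.cosh x) - x) atTop (𝓝 (-Real.log 2)) := by
  have h_exp : Tendsto (fun x : ℝ => (1 + Real.exp (-(2 * x))) / 2) atTop (𝓝 ((1 + 0) / 2)) :=
    ((Real.tendsto_exp_neg_atTop_nhds_zero.comp
      (tendsto_id.const_mul_atTop two_pos)).const_add 1).div_const 2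
  have h_log := h_exp.log (by norm_num)
  rw [add_zero, one_div, Real.log_inv] at h_log
  refine h_log.congr fun x => ?_
  have h_cosh : Real.cosh x = Real.exp x * ((1 + Real.exp (-(2 * x))) / 2) := by
    rw [Real.cosh_eq, mul_div_assoc', mul_add, mul_one, ← Real.exp_add]
    ring_nf
  rw [h_cosh, Real.log_mul (Real.exp_ne_zero x) (by positivity), Real.log_exp]
  ring

theorem tendsto_log_cosh_sub_log_cosh {σ : ℝ} (hσ : 0 < σ) (ρ : ℝ) :
    Tendsto (fun r => Real.log (Real.cosh (σ * (r - ρ))) - Real.log (Real.cosh (σ * (r + ρ))))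
      atTop (𝓝 (-(2 * σ * ρ))) := by
  have h_sub : Tendsto (fun r : ℝ => σ * (r - ρ)) atTop atTop :=
    (tendsto_atTop_add_const_right _ (-ρ) tendsto_id).const_mul_atTop hσ
  have h_add : Tendsto (fun r : ℝ => σ * (r + ρ)) atTop atTop :=
    (tendsto_atTop_add_const_right _ ρ tendsto_id).const_mul_atTop hσ
  have h := ((tendsto_log_cosh_sub_self.comp h_sub).sub
    (tendsto_log_cosh_sub_self.comp h_add)).add_const (-(2 * σ * ρ))
  rw [sub_self, zero_add] at h
  refine h.congr fun r => ?_
  simp only [Function.comp_apply]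
  ring

theorem tendsto_Fanti_sub_self {σ ρ : ℝ} (hσ : 0 < σ) (hρ : 0 < ρ) :
    Tendsto (fun r => Fanti σ ρ r - r) atTop
      (𝓝 (-ρ * Real.cosh (σ * ρ) / Real.sinh (σ * ρ))) := by
  have h_sinh : Real.sinh (σ * ρ) ≠ 0 := (Real.sinh_pos_iff.2 (mul_pos hσ hρ)).ne'
  have h := ((tendsto_log_cosh_sub_log_cosh hσ ρ).const_mul (Real.cosh (σ * ρ))).div_const
    (2 * σ * Real.sinh (σ * ρ))
  convert h using 2
  · rw [Fanti]
    field_simp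
    ring
  · field_simp

theorem g_far_field (σ ρ : ℝ) (hσ : 0 < σ) (hρ : 0 < ρ) :
    Filter.Tendsto (fun r => r * (Fanti σ ρ r / r - 1)) Filter.atTop
      (nhds (-ρ * Real.cosh (σ * ρ) / Real.sinh (σ * ρ))) ∧
    Filter.Tendsto (fun r => Fanti σ ρ r / r) Filter.atTop (nhds 1) := by
  have h := tendsto_Fanti_sub_self hσ hρ
  constructor
  · refine h.congr' ?_
    filter_upwards [eventually_ne_atTop 0] with r hr
    field_simp
  · have h_one := (h.div_atTop tendsto_id).add_const 1
    rw [zero_add] at h_one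
    refine h_one.congr' ?_
    filter_upwards [eventually_ne_atTop 0] with r hr
    simp only [id]
    field_simp
    ring
end
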